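/- arXiv:2307.14622 — 2 statements merged into one kernel-verified Lean document; each statement's English description precedes it below -/
import Mathlib

section
/- Let F₃ = ℤ³ be the free abelian group with basis θ₁, θ₂, θ₃ and F₂ = ℤ² the free abelian group with basis β₁, β₂. Let λ₁, λ₂, λ₃ ∈ F₃ and δ₁, δ₂ ∈ F₂. Let Ψ : F₃ → F₃ be the group homomorphism determined by Ψ(θ₁) = θ₂, Ψ(θ₂) = θ₁, Ψ(θ₃) = θ₃, and suppose Ψ(λ₁) = λ₂, Ψ(λ₂) = λ₁, Ψ(λ₃) = λ₃. Let Φ : F₃ → F₂ be the group homomorphism determined by Φ(θ₁) = β₁, Φ(θ₂) = β₁, Φ(θ₃) = 2β₂, and suppose Φ(λ₁) = δ₁, Φ(λ₂) = δ₁, Φ(λ₃) = 2δ₂. Write λ₁ = xθ₁ + yθ₂ + zθ₃ with x, y, z ∈ ℤ. If the quotient group F₂ / ⟨δ₁, δ₂⟩ is trivial, then the quotient group F₃ / ⟨λ₁, λ₂, λ₃⟩ is isomorphic to the cyclic group ℤ/(x − y)ℤ. -/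
/-- The expansion of an element of `ℤ³` in the standard basis. -/
lemma eq_sum_zsmul_single_fin_three (v : Fin 3 → ℤ) :
    v = v 0 • Pi.single 0 1 + v 1 • Pi.single 1 1 + v 2 • Pi.single 2 1 := by
  ext i
  fin_cases i <;> simp

/-- If two vectors generate `ℤ²`, their determinant squares to `1`. -/
lemma det_mul_self_of_closure_pair_eq_top {d₁ d₂ : Fin 2 → ℤ}
    (h : AddSubgroup.closure {d₁, d₂} = ⊤) :
    (d₁ 0 * d₂ 1 - d₁ 1 * d₂ 0) * (d₁ 0 * d₂ 1 - d₁ 1 * d₂ 0) = 1 := by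
  have hmem (v : Fin 2 → ℤ) : ∃ m k : ℤ, m • d₁ + k • d₂ = v :=
    AddSubgroup.mem_closure_pair.mp (h ▸ AddSubgroup.mem_top v)
  obtain ⟨m, k, hmk⟩ := hmem ![1, 0]
  obtain ⟨m', k', hmk'⟩ := hmem ![0, 1]
  have h₀ : m * d₁ 0 + k * d₂ 0 = 1 := by simpa using congrFun hmk 0
  have h₁ : m * d₁ 1 + k * d₂ 1 = 0 := by simpa using congrFun hmk 1
  have h_snd₀ : m' * d₁ 0 + k' * d₂ 0 = 0 := by simpa using congrFun hmk' 0
  have h_snd₁ : m' * d₁ 1 + k' * d₂ 1 = 1 := by simpa using congrFun hmk' 1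
  refine Int.isUnit_mul_self (IsUnit.of_mul_eq_one (m * k' - k * m') ?_)
  linear_combination (m' * d₁ 1 + k' * d₂ 1) * h₀ - (m' * d₁ 0 + k' * d₂ 0) * h₁ + h_snd₁

/-- The homomorphism `v ↦ det (v, l, l')` on `ℤ³`. -/
def detHom (l l' : Fin 3 → ℤ) : (Fin 3 → ℤ) →+ ℤ where
  toFun v := v 0 * (l 1 * l' 2 - l 2 * l' 1) - v 1 * (l 0 * l' 2 - l 2 * l' 0)
    + v 2 * (l 0 * l' 1 - l 1 * l' 0)
  map_zero' := by simp
  map_add' v w := by simp only [Pi.add_apply]; ring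

lemma detHom_apply (l l' v : Fin 3 → ℤ) :
    detHom l l' v = v 0 * (l 1 * l' 2 - l 2 * l' 1) - v 1 * (l 0 * l' 2 - l 2 * l' 0)
      + v 2 * (l 0 * l' 1 - l 1 * l' 0) := rfl

/-- The subgroup generated by `(x, y, z)`, `(y, x, z)`, `(a, a, w)` has cyclic quotient of order
`|x - y|` when `(x + y) w - 2 z a` is a unit. -/
lemma nonempty_quotient_closure_addEquiv_zmod (x y z a w : ℤ)
    (hD : ((x + y) * w - 2 * z * a) * ((x + y) * w - 2 * z * a) = 1) :
    Nonempty (((Fin 3 → ℤ) ⧸ AddSubgroup.closure {![x, y, z], ![y, x, z], ![a, a, w]}) ≃+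
      ZMod (x - y).natAbs) := by
  set D := (x + y) * w - 2 * z * a with hDdef
  let g := detHom ![x, y, z] ![a, a, w]
  let f : (Fin 3 → ℤ) →+ ZMod (x - y).natAbs := (Int.castAddHom _).comp g
  have hg (v : Fin 3 → ℤ) :
      g v = v 0 * (y * w - z * a) - v 1 * (x * w - z * a) + v 2 * (x * a - y * a) := by
    simp [g, detHom_apply]
  have hf (v : Fin 3 → ℤ) : f v = 0 ↔ x - y ∣ g v := by
    simp [f, ZMod.intCast_zmod_eq_zero_iff_dvd]
  have hsurj : Function.Surjective f := by
    refine (ZMod.intCast_surjective).comp fun t => ⟨![D * t, -(D * t), 0], ?_⟩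
    simp only [hg, Matrix.cons_val]
    linear_combination t * hD + (t * D) * (-hDdef)
  have hker : AddSubgroup.closure {![x, y, z], ![y, x, z], ![a, a, w]} = f.ker := by
    apply le_antisymm
    · rw [AddSubgroup.closure_le]
      rintro v (rfl | rfl | rfl) <;> rw [SetLike.mem_coe, AddMonoidHom.mem_ker, hf, hg]
      · exact ⟨0, by simp; ring⟩
      · exact ⟨-D, by simp [hDdef]; ring⟩
      · exact ⟨0, by simp; ring⟩
    · intro v hv
      obtain ⟨k, hk⟩ := (hf v).mp hv
      rw [hg] at hk
      have hv' : v = (D * (k + ((v 0 + v 1) * w - 2 * a * v 2))) • ![x, y, z]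
          + (-(D * k)) • ![y, x, z]
          + (D * ((x + y) * v 2 - z * (v 0 + v 1))) • ![a, a, w] := by
        ext i
        fin_cases i <;> simp
        · linear_combination (-v 0) * hD + D * hk + D * v 0 * hDdef
        · linear_combination (-v 1) * hD - D * hk + D * v 1 * hDdef
        · linear_combination (-v 2) * hD + D * v 2 * hDdef
      rw [hv']
      refine add_mem (add_mem ?_ ?_) ?_ <;>
        exact zsmul_mem (AddSubgroup.subset_closure (by simp)) _
  exact ⟨(QuotientAddGroup.quotientAddEquivOfEq hker).trans
    (QuotientAddGroup.quotientKerEquivOfSurjective f hsurj)⟩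

/-- Lemma on abelian group presentations: with `Ψ : ℤ³ → ℤ³` swapping the first
two basis vectors and fixing the third, `Φ : ℤ³ → ℤ²` sending `θ₁, θ₂ ↦ β₁`
and `θ₃ ↦ 2β₂`, relators `λ₁, λ₂, λ₃` and `δ₁, δ₂` compatible with `Ψ` and `Φ`,
and `λ₁ = xθ₁ + yθ₂ + zθ₃`: if `ℤ²/⟨δ₁, δ₂⟩` is trivial then
`ℤ³/⟨λ₁, λ₂, λ₃⟩ ≅ ℤ/(x - y)ℤ`. -/
theorem presentation_quotient_cyclic
    (Ψ : (Fin 3 → ℤ) →+ (Fin 3 → ℤ)) (Φ : (Fin 3 → ℤ) →+ (Fin 2 → ℤ))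
    (l₁ l₂ l₃ : Fin 3 → ℤ) (d₁ d₂ : Fin 2 → ℤ)
    (hΨ1 : Ψ (Pi.single 0 1) = Pi.single 1 1)
    (hΨ2 : Ψ (Pi.single 1 1) = Pi.single 0 1)
    (hΨ3 : Ψ (Pi.single 2 1) = Pi.single 2 1)
    (hΨl1 : Ψ l₁ = l₂) (hΨl2 : Ψ l₂ = l₁) (hΨl3 : Ψ l₃ = l₃)
    (hΦ1 : Φ (Pi.single 0 1) = Pi.single 0 1)
    (hΦ2 : Φ (Pi.single 1 1) = Pi.single 0 1)
    (hΦ3 : Φ (Pi.single 2 1) = 2 • Pi.single 1 1)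
    (hΦl1 : Φ l₁ = d₁) (hΦl2 : Φ l₂ = d₁) (hΦl3 : Φ l₃ = 2 • d₂)
    (x y z : ℤ) (hl1 : l₁ = ![x, y, z])
    (htriv : Subsingleton ((Fin 2 → ℤ) ⧸ AddSubgroup.closure {d₁, d₂})) :
    Nonempty (((Fin 3 → ℤ) ⧸ AddSubgroup.closure {l₁, l₂, l₃}) ≃+
      ZMod (x - y).natAbs) := by
  have hΨ (v : Fin 3 → ℤ) : Ψ v = ![v 1, v 0, v 2] := by
    conv_lhs => rw [eq_sum_zsmul_single_fin_three v]
    rw [map_add, map_add, map_zsmul, map_zsmul, map_zsmul, hΨ1, hΨ2, hΨ3]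
    ext i
    fin_cases i <;> simp
  have hΦ (v : Fin 3 → ℤ) : Φ v = ![v 0 + v 1, 2 * v 2] := by
    conv_lhs => rw [eq_sum_zsmul_single_fin_three v]
    rw [map_add, map_add, map_zsmul, map_zsmul, map_zsmul, hΦ1, hΦ2, hΦ3]
    ext i
    fin_cases i <;> simp [mul_comm]
  have hl2 : l₂ = ![y, x, z] := by rw [← hΨl1, hΨ, hl1]; rfl
  have hl3_symm : l₃ 1 = l₃ 0 := by simpa [hΨ] using congrFun hΨl3 0
  have hl3 : l₃ = ![l₃ 0, l₃ 0, l₃ 2] := by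
    ext i
    fin_cases i <;> simp [hl3_symm]
  have hd1 : d₁ = ![x + y, 2 * z] := by rw [← hΦl1, hΦ, hl1]; rfl
  have hd20 : d₂ 0 = l₃ 0 := by
    have h := congrFun hΦl3 0
    simp [hΦ, hl3_symm] at h
    lia
  have hd21 : d₂ 1 = l₃ 2 := by
    have h := congrFun hΦl3 1
    simp [hΦ] at h
    lia
  have hD := det_mul_self_of_closure_pair_eq_top
    ((AddSubgroup.eq_top_iff' _).mpr fun v =>
      (QuotientAddGroup.eq_zero_iff v).mp (htriv.elim _ _))
  rw [hl1, hl2, hl3]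
  apply nonempty_quotient_closure_addEquiv_zmod
  simpa [hd1, hd20, hd21] using hD
end

section
/- Let a₁, a₂, a₃, a₄, a₅ be integers such that (a₁ + a₂)a₅ − 2a₃a₄ = 1 or (a₁ + a₂)a₅ − 2a₃a₄ = −1. Then the quotient of ℤ³ by the subgroup generated by the three elements (a₁, a₂, a₃), (a₂, a₁, a₃) and (a₄, a₄, a₅) is isomorphic to the cyclic group ℤ/(a₁ − a₂)ℤ. -/
/-- The homomorphism `(x, y, z) ↦ x - y` from `ℤ³` to `ℤ/nℤ`. -/
def subModHom (n : ℕ) : (Fin 3 → ℤ) →+ ZMod n :=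
  (Int.castAddHom (ZMod n)).comp
    (Pi.evalAddMonoidHom (fun _ : Fin 3 => ℤ) 0 - Pi.evalAddMonoidHom (fun _ : Fin 3 => ℤ) 1)

theorem subModHom_apply (n : ℕ) (v : Fin 3 → ℤ) :
    subModHom n v = ((v 0 - v 1 : ℤ) : ZMod n) := rfl

theorem subModHom_surjective (n : ℕ) : Function.Surjective (subModHom n) := by
  intro c
  obtain ⟨m, rfl⟩ := ZMod.intCast_surjective c
  exact ⟨![m, 0, 0], by simp [subModHom_apply]⟩

theorem mem_ker_subModHom_natAbs (d : ℤ) (v : Fin 3 → ℤ) :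
    v ∈ (subModHom d.natAbs).ker ↔ d ∣ v 0 - v 1 := by
  rw [AddMonoidHom.mem_ker, subModHom_apply, ZMod.intCast_zmod_eq_zero_iff_dvd, Int.natAbs_dvd]

theorem closure_eq_ker_subModHom (a₁ a₂ a₃ a₄ a₅ e : ℤ) (he : e * e = 1)
    (hdet : (a₁ + a₂) * a₅ - 2 * a₃ * a₄ = e) :
    AddSubgroup.closure {![a₁, a₂, a₃], ![a₂, a₁, a₃], ![a₄, a₄, a₅]} =
      (subModHom (a₁ - a₂).natAbs).ker := by
  apply le_antisymm
  · rw [AddSubgroup.closure_le]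
    rintro v (rfl | rfl | rfl) <;> rw [SetLike.mem_coe, mem_ker_subModHom_natAbs]
    · simp
    · exact ⟨-1, by simp⟩
    · simp
  · intro v hv
    obtain ⟨k, hk⟩ := (mem_ker_subModHom_natAbs _ _).1 hv
    set y := v 1 - k * a₂ with hy
    set z := v 2 - k * a₃ with hz
    set p := e * (a₅ * y - a₄ * z) with hp
    set q := e * ((a₁ + a₂) * z - 2 * a₃ * y) with hq
    have hpy : p * (a₁ + a₂) + q * a₄ = y := by
      linear_combination (a₁ + a₂) * hp + a₄ * hq + e * y * hdet + y * he
    have hqz : 2 * a₃ * p + a₅ * q = z := by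
      linear_combination 2 * a₃ * hp + a₅ * hq + e * z * hdet + z * he
    have hdecomp : v = (k + p) • ![a₁, a₂, a₃] + p • ![a₂, a₁, a₃] + q • ![a₄, a₄, a₅] := by
      ext i
      fin_cases i
      · simp
        linear_combination hk - hpy + hy
      · simp
        linear_combination -hpy + hy
      · simp
        linear_combination -hqz + hz
    rw [hdecomp]
    refine add_mem (add_mem ?_ ?_) ?_ <;>
      exact zsmul_mem (AddSubgroup.subset_closure (by simp)) _

/-- If `(a₁ + a₂)a₅ − 2a₃a₄ = ±1`, then the quotient of `ℤ³` by the subgroup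
generated by `(a₁, a₂, a₃)`, `(a₂, a₁, a₃)`, `(a₄, a₄, a₅)` is isomorphic to
the cyclic group `ℤ/(a₁ − a₂)ℤ`. -/
theorem quotient_iso_cyclic_of_det_pm_one
    (a₁ a₂ a₃ a₄ a₅ : ℤ)
    (hdet : (a₁ + a₂) * a₅ - 2 * a₃ * a₄ = 1 ∨
      (a₁ + a₂) * a₅ - 2 * a₃ * a₄ = -1) :
    Nonempty (((Fin 3 → ℤ) ⧸
      AddSubgroup.closure {![a₁, a₂, a₃], ![a₂, a₁, a₃], ![a₄, a₄, a₅]}) ≃+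
      ZMod (a₁ - a₂).natAbs) := by
  obtain ⟨e, he, hdet⟩ :
      ∃ e : ℤ, e * e = 1 ∧ (a₁ + a₂) * a₅ - 2 * a₃ * a₄ = e := by
    rcases hdet with h | h
    · exact ⟨1, by norm_num, h⟩
    · exact ⟨-1, by norm_num, h⟩
  exact ⟨(QuotientAddGroup.quotientAddEquivOfEq
    (closure_eq_ker_subModHom a₁ a₂ a₃ a₄ a₅ e he hdet)).trans
    (QuotientAddGroup.quotientKerEquivOfSurjective _ (subModHom_surjective _))⟩
end
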